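/- Let p be a prime, e ≥ 1 an integer, and n ≥ 1 an integer with p not dividing n, and let R = (ℤ_{p^e})[x] / ⟨x^n − 1⟩. Let C be an ideal of R (a cyclic code of length n over ℤ_{p^e}). Then C is a free ℤ_{p^e}-module if and only if there exists a polynomial g ∈ (ℤ_{p^e})[x] such that g divides x^n − 1 in (ℤ_{p^e})[x] and C is the ideal of R generated by the image of g. -/

import Mathlib

open Polynomial

theorem ZMod.isLocalRing_prime_pow {p e : ℕ} (hp : p.Prime) (he : 0 < e) :
    IsLocalRing (ZMod (p ^ e)) := by
  have : Fact (1 < p ^ e) := ⟨Nat.one_lt_pow he.ne' hp.one_lt⟩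
  have : NeZero (p ^ e) := ⟨(pow_pos hp.pos e).ne'⟩
  refine IsLocalRing.of_isUnit_or_isUnit_one_sub_self fun a => ?_
  obtain ⟨k, rfl⟩ := ZMod.natCast_zmod_surjective a
  by_cases hk : p ∣ k
  · obtain ⟨m, rfl⟩ := hk
    refine Or.inr (IsNilpotent.isUnit_one_sub ⟨e, ?_⟩)
    rw [← Nat.cast_pow, ZMod.natCast_eq_zero_iff, mul_pow]
    exact dvd_mul_right _ _
  · refine Or.inl ((ZMod.isUnit_iff_coprime _ _).2 ?_)
    exact (((Nat.Prime.coprime_iff_not_dvd hp).2 hk).symm).pow_right e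

/-- An element of `ℤ/N` killed by the annihilator of `a` is a multiple of `a`. -/
theorem ZMod.dvd_of_annihilator_le {N : ℕ} (hN : N ≠ 0) (a y : ZMod N)
    (h : ∀ r : ZMod N, r * a = 0 → r * y = 0) : a ∣ y := by
  have : NeZero N := ⟨hN⟩
  obtain ⟨k, rfl⟩ := ZMod.natCast_zmod_surjective a
  obtain ⟨m, rfl⟩ := ZMod.natCast_zmod_surjective y
  obtain ⟨c, hc⟩ := Nat.gcd_dvd_right k N
  obtain ⟨d, hd⟩ := Nat.gcd_dvd_left k N
  have hc0 : 0 < c := Nat.pos_of_ne_zero fun h0 => hN (by rw [hc, h0, mul_zero])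
  have hca : ((c : ℕ) : ZMod N) * (k : ZMod N) = 0 := by
    rw [← Nat.cast_mul, ZMod.natCast_eq_zero_iff]
    exact ⟨d, by conv_lhs => rw [hd]
                 conv_rhs => rw [hc]
                 ring⟩
  have hcm := h _ hca
  rw [← Nat.cast_mul, ZMod.natCast_eq_zero_iff] at hcm
  have hgm : k.gcd N ∣ m := by
    refine Nat.dvd_of_mul_dvd_mul_left hc0 ?_
    rwa [mul_comm c, ← hc]
  obtain ⟨t, rfl⟩ := hgm
  have hbez : ((k.gcd N : ℕ) : ZMod N) = k * (k.gcdA N : ZMod N) := by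
    have := congrArg (Int.cast : ℤ → ZMod N) (Nat.gcd_eq_gcd_ab k N)
    simpa using this
  rw [Nat.cast_mul, hbez, mul_assoc]
  exact dvd_mul_right _ _

/-- The ring `ℤ/N` is self-injective. -/
theorem ZMod.injective_self {N : ℕ} (hN : N ≠ 0) : Module.Injective (ZMod N) (ZMod N) := by
  refine Module.Baer.injective fun I g => ?_
  have hP : IsPrincipalIdealRing (ZMod N) :=
    IsPrincipalIdealRing.of_surjective (Int.castRingHom (ZMod N)) (ZMod.intCast_surjective)
  obtain ⟨a, ha⟩ := hP.principal I
  have haI : a ∈ I := by rw [ha]; exact Submodule.mem_span_singleton_self a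
  obtain ⟨c, hc⟩ := ZMod.dvd_of_annihilator_le hN a (g ⟨a, haI⟩) fun r hr => by
    rw [← smul_eq_mul, ← map_smul]
    convert map_zero g
    exact Subtype.ext hr
  refine ⟨LinearMap.mulRight (ZMod N) c, fun x hx => ?_⟩
  obtain ⟨r, rfl⟩ := Submodule.mem_span_singleton.1 (ha ▸ hx)
  have : (⟨r • a, hx⟩ : I) = r • ⟨a, haI⟩ := rfl
  rw [this, map_smul g, hc, LinearMap.mulRight_apply, smul_eq_mul, smul_eq_mul, mul_assoc]

/-- Over a self-injective ring, the quotient of a projective algebra by an ideal that is a finite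
free module is projective. -/
theorem Ideal.projective_quotient_of_free {A Q : Type*} [CommRing A] [CommRing Q] [Algebra A Q]
    [Module.Injective A A] [Module.Projective A Q] (C : Ideal Q) [Module.Free A C]
    [Module.Finite A C] : Module.Projective A (Q ⧸ C) := by
  let b := Module.Free.chooseBasis A C
  obtain ⟨r₀, hr₀⟩ := Module.Injective.extension_property A
    (Module.Free.ChooseBasisIndex A C → A) C Q (C.subtype.restrictScalars A)
    Subtype.val_injective b.equivFun.toLinearMap
  let r : Q →ₗ[A] C := b.equivFun.symm.toLinearMap ∘ₗ r₀
  have hr (c : C) : r c = c := by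
    have : r₀ c = b.equivFun c := LinearMap.congr_fun hr₀ c
    simp [r, this]
  let s₀ : Q →ₗ[A] Q := LinearMap.id - (C.subtype.restrictScalars A) ∘ₗ r
  let s : (Q ⧸ C) →ₗ[A] Q := ((C.restrictScalars A).liftQ s₀ fun c hc => by
    have := hr ⟨c, hc⟩
    simp only [] at this
    simp [s₀, this]) ∘ₗ (Submodule.Quotient.restrictScalarsEquiv A C).symm.toLinearMap
  have hs : (C.mkQ.restrictScalars A) ∘ₗ s = LinearMap.id := LinearMap.ext fun x => by
    obtain ⟨x, rfl⟩ := C.mkQ_surjective x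
    have hx : s (C.mkQ x) = x - (r x : Q) := rfl
    rw [LinearMap.comp_apply, hx, LinearMap.restrictScalars_apply, map_sub, LinearMap.id_apply,
      sub_eq_self, C.mkQ_apply, Submodule.Quotient.mk_eq_zero]
    exact (r x).2
  exact Module.Projective.of_split s _ hs

/-- The kernel of a surjection from `A[X]` onto a finite free algebra is generated by the
characteristic polynomial of the image of `X`. -/
theorem Polynomial.ker_aeval_eq_span_charpoly {A B : Type*} [CommRing A] [CommRing B]
    [Algebra A B] [Module.Free A B] [Module.Finite A B] (x : B)
    (hx : Function.Surjective (aeval (R := A) x)) :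
    RingHom.ker (aeval (R := A) x) = Ideal.span {(Algebra.lmul A B x).charpoly} := by
  nontriviality A
  set g := (Algebra.lmul A B x).charpoly with hg
  have hmonic : g.Monic := LinearMap.charpoly_monic _
  have hroot : aeval x g = 0 := by
    have h := LinearMap.aeval_self_charpoly (Algebra.lmul A B x)
    rw [← hg, aeval_algHom_apply] at h
    simpa using congrArg (fun φ : Module.End A B => φ 1) h
  have hle : ∀ a ∈ Ideal.span {g}, aeval x a = 0 := fun a ha => by
    obtain ⟨c, rfl⟩ := Ideal.mem_span_singleton.1 ha
    rw [map_mul, hroot, zero_mul]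
  let φ : (A[X] ⧸ Ideal.span {g}) →ₐ[A] B := Ideal.Quotient.liftₐ _ (aeval x) hle
  have : Module.Free A (A[X] ⧸ Ideal.span {g}) := hmonic.free_quotient
  have : Module.Finite A (A[X] ⧸ Ideal.span {g}) := hmonic.finite_quotient
  have hφ : Function.Surjective φ.toLinearMap := fun y => by
    obtain ⟨q, rfl⟩ := hx y
    exact ⟨Ideal.Quotient.mk _ q, rfl⟩
  have hrank : Module.finrank A (A[X] ⧸ Ideal.span {g}) ≤ Module.finrank A B := by
    rw [finrank_quotient_span_eq_natDegree' hmonic, hg, LinearMap.charpoly_natDegree]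
  have hbij := OrzechProperty.bijective_of_surjective_of_finrank_le φ.toLinearMap hφ hrank
  refine le_antisymm (fun q hq => ?_) hle
  rw [← Ideal.Quotient.eq_zero_iff_mem]
  exact hbij.1 ((show φ (Ideal.Quotient.mk _ q) = aeval x q from rfl).trans
    (hq.trans (map_zero φ.toLinearMap).symm))

/-- An ideal of `A[X]/(f)` whose quotient is a finite free module is generated by a divisor
of `f`. -/
theorem Polynomial.exists_dvd_and_eq_span_of_free_quotient {A : Type*} [CommRing A] (f : A[X])
    (C : Ideal (A[X] ⧸ Ideal.span {f}))
    [Module.Free A ((A[X] ⧸ Ideal.span {f}) ⧸ C)] [Module.Finite A ((A[X] ⧸ Ideal.span {f}) ⧸ C)] :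
    ∃ g : A[X], g ∣ f ∧ C = Ideal.span {Ideal.Quotient.mk (Ideal.span {f}) g} := by
  let π := Ideal.Quotient.mk (Ideal.span {f})
  let x : (A[X] ⧸ Ideal.span {f}) ⧸ C := Ideal.Quotient.mk C (π X)
  have hae (q : A[X]) : aeval x q = Ideal.Quotient.mk C (π q) := by
    have : aeval x =
        (Ideal.Quotient.mkₐ A C).comp (Ideal.Quotient.mkₐ A (Ideal.span {f})) := by
      ext
      simp [x, π]
    rw [this]
    rfl
  have hker := ker_aeval_eq_span_charpoly (A := A) x fun y => by
    obtain ⟨y, rfl⟩ := Ideal.Quotient.mk_surjective y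
    obtain ⟨q, rfl⟩ := Ideal.Quotient.mk_surjective y
    exact ⟨q, hae q⟩
  have hmem (q : A[X]) : (Algebra.lmul A _ x).charpoly ∣ q ↔ π q ∈ C := by
    rw [← Ideal.mem_span_singleton, ← hker, RingHom.mem_ker, hae, Ideal.Quotient.eq_zero_iff_mem]
  refine ⟨(Algebra.lmul A _ x).charpoly, (hmem f).2 ?_, le_antisymm (fun c hc => ?_) ?_⟩
  · rw [Ideal.Quotient.eq_zero_iff_mem.2 (Ideal.mem_span_singleton_self f)]
    exact C.zero_mem
  · obtain ⟨q, rfl⟩ := Ideal.Quotient.mk_surjective c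
    exact Ideal.mem_span_singleton.2 (_root_.map_dvd π ((hmem q).2 hc))
  · rw [Ideal.span_singleton_le_iff_mem]
    exact (hmem _).1 dvd_rfl

/-- If `g` and `h` are coprime, then the ideal generated by `g` in `A[X]/(g * h)` is a direct
summand, given by a retraction of the inclusion. -/
theorem Polynomial.exists_retraction_of_isCoprime {A : Type*} [CommRing A] {g h : A[X]}
    (hgh : IsCoprime g h) (C : Ideal (A[X] ⧸ Ideal.span {g * h}))
    (hC : C = Ideal.span {Ideal.Quotient.mk (Ideal.span {g * h}) g}) :
    ∃ s : (A[X] ⧸ Ideal.span {g * h}) →ₗ[A] C, s ∘ₗ C.subtype.restrictScalars A = .id := by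
  obtain ⟨a, b, hab⟩ := hgh
  let π := Ideal.Quotient.mk (Ideal.span {g * h})
  have hmem (y) : π (a * g) * y ∈ C := by
    rw [hC, map_mul]
    exact Ideal.mul_mem_right _ _ (Ideal.mul_mem_left _ _ (Ideal.mem_span_singleton_self _))
  refine ⟨(LinearMap.mulLeft A (π (a * g))).codRestrict (C.restrictScalars A) hmem, ?_⟩
  ext ⟨c, hc⟩
  obtain ⟨y, rfl⟩ := Ideal.mem_span_singleton.1 (hC ▸ hc)
  have h0 : π (g * h) = 0 := Ideal.Quotient.eq_zero_iff_mem.2 (Ideal.mem_span_singleton_self _)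
  have h1 : π a * π g + π b * π h = 1 := by simpa using congrArg π hab
  rw [map_mul] at h0
  change π (a * g) * (π g * y) = π g * y
  rw [map_mul]
  linear_combination (π g * y) * h1 - π b * y * h0

/-- A cyclic code of length `n` over `ℤ/pᵉ` (with `p ∤ n`), i.e. an ideal of
`R = (ℤ/pᵉ)[x]/⟨xⁿ - 1⟩`, is free as a `ℤ/pᵉ`-module if and only if it is
generated by (the image of) a divisor `g` of `xⁿ - 1`. -/
theorem stmt_10 (p e n : ℕ) (hp : p.Prime) (he : 0 < e) (hn : 0 < n)
    (hpn : ¬ p ∣ n)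
    (C : Ideal (Polynomial (ZMod (p ^ e)) ⧸
      Ideal.span {(Polynomial.X : Polynomial (ZMod (p ^ e))) ^ n - 1})) :
    Module.Free (ZMod (p ^ e)) C ↔
      ∃ g : Polynomial (ZMod (p ^ e)),
        g ∣ (Polynomial.X : Polynomial (ZMod (p ^ e))) ^ n - 1 ∧
        C = Ideal.span
          {Ideal.Quotient.mk
            (Ideal.span {(Polynomial.X : Polynomial (ZMod (p ^ e))) ^ n - 1}) g} := by
  have : IsLocalRing (ZMod (p ^ e)) := ZMod.isLocalRing_prime_pow hp he
  have hN : p ^ e ≠ 0 := (pow_pos hp.pos e).ne'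
  have : NeZero (p ^ e) := ⟨hN⟩
  have hmonic : ((X : (ZMod (p ^ e))[X]) ^ n - 1).Monic := by
    simpa using monic_X_pow_sub_C (1 : ZMod (p ^ e)) hn.ne'
  have hsep : ((X : (ZMod (p ^ e))[X]) ^ n - 1).Separable := by
    have hu : IsUnit (n : ZMod (p ^ e)) :=
      (ZMod.isUnit_iff_coprime _ _).2 ((((Nat.Prime.coprime_iff_not_dvd hp).2 hpn).symm).pow_right e)
    simpa using separable_X_pow_sub_C_unit (1 : (ZMod (p ^ e))ˣ) hu
  generalize (X : (ZMod (p ^ e))[X]) ^ n - 1 = f at *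
  have : Module.Free (ZMod (p ^ e)) ((ZMod (p ^ e))[X] ⧸ Ideal.span {f}) := hmonic.free_quotient
  have : Module.Finite (ZMod (p ^ e)) ((ZMod (p ^ e))[X] ⧸ Ideal.span {f}) :=
    hmonic.finite_quotient
  have : Module.Finite (ZMod (p ^ e)) C :=
    inferInstanceAs (Module.Finite (ZMod (p ^ e)) (C.restrictScalars (ZMod (p ^ e))))
  constructor
  · intro _
    have := ZMod.injective_self hN
    have := C.projective_quotient_of_free (A := ZMod (p ^ e))
    have : Module.Finite (ZMod (p ^ e)) (((ZMod (p ^ e))[X] ⧸ Ideal.span {f}) ⧸ C) :=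
      Module.Finite.of_surjective (Ideal.Quotient.mkₐ (ZMod (p ^ e)) C).toLinearMap
        Ideal.Quotient.mk_surjective
    have : Module.Free (ZMod (p ^ e)) (((ZMod (p ^ e))[X] ⧸ Ideal.span {f}) ⧸ C) :=
      Module.free_of_flat_of_isLocalRing
    exact exists_dvd_and_eq_span_of_free_quotient f C
  · rintro ⟨g, ⟨h, rfl⟩, hC⟩
    obtain ⟨s, hs⟩ := exists_retraction_of_isCoprime hsep.isCoprime C hC
    have := Module.Projective.of_split _ s hs
    exact Module.free_of_flat_of_isLocalRing
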